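/- arXiv:1912.08906 — 2 statements merged into one kernel-verified Lean document; each statement's English description precedes it below -/
import Mathlib

section
/- Let p be an odd prime, let G be a quasi-powerful p-group and let N be a normal subgroup of G. Then the quotient G/N is a quasi-powerful p-group; that is, (G/N)/Z(G/N) is powerful. -/
/-- The subgroup of `G` generated by all `n`-th powers. -/
def powSubgroup (G : Type*) [Group G] (n : ℕ) : Subgroup G :=
  Subgroup.closure {x : G | ∃ g : G, g ^ n = x}

/-- `Ω_k`-type subgroup: generated by all elements whose `n`-th power is trivial. -/
def omegaSubgroup (G : Type*) [Group G] (n : ℕ) : Subgroup G :=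
  Subgroup.closure {g : G | g ^ n = 1}

/-- A group is powerful (for a prime `p`) if `[G,G] ≤ G^p`. -/
def IsPowerful (p : ℕ) (G : Type*) [Group G] : Prop :=
  commutator G ≤ powSubgroup G p

/-- A group is quasi-powerful (for a prime `p`) if `G/Z(G)` is powerful. -/
def IsQuasiPowerful (p : ℕ) (G : Type*) [Group G] : Prop :=
  IsPowerful p (G ⧸ Subgroup.center G)

/-- The commutator `[x,y] = x⁻¹y⁻¹xy`. -/
def pcomm {G : Type*} [Group G] (a b : G) : G := a⁻¹ * b⁻¹ * a * b

/-- The image of a powerful group under a surjective homomorphism is powerful. -/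
theorem IsPowerful.of_surjective {p : ℕ} {G H : Type*} [Group G] [Group H] (hG : IsPowerful p G)
    (f : G →* H) (hf : Function.Surjective f) : IsPowerful p H := by
  have hcomm : commutator H = (commutator G).map f := by
    rw [commutator_def, commutator_def, Subgroup.map_commutator,
      Subgroup.map_top_of_surjective f hf]
  unfold IsPowerful
  rw [hcomm]
  refine (Subgroup.map_mono hG).trans ?_
  rw [powSubgroup, MonoidHom.map_closure, powSubgroup]
  refine Subgroup.closure_mono ?_
  rintro _ ⟨_, ⟨g, rfl⟩, rfl⟩
  exact ⟨f g, (map_pow f g p).symm⟩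

/-- A surjective homomorphism maps the centre into the centre. -/
theorem Subgroup.center_le_comap_center {G H : Type*} [Group G] [Group H] (f : G →* H)
    (hf : Function.Surjective f) : Subgroup.center G ≤ (Subgroup.center H).comap f := by
  intro z hz
  rw [Subgroup.mem_comap, Subgroup.mem_center_iff]
  intro y
  obtain ⟨g, rfl⟩ := hf y
  rw [← map_mul, ← map_mul, Subgroup.mem_center_iff.mp hz g]

theorem quotient_quasiPowerful (p : ℕ) (hp : p.Prime) (hodd : Odd p)
    (G : Type*) [Group G] [Finite G]
    (hG : IsPGroup p G) (hQP : IsQuasiPowerful p G) (N : Subgroup G) [N.Normal] :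
    IsQuasiPowerful p (G ⧸ N) :=
  IsPowerful.of_surjective hQP
    (QuotientGroup.map _ _ (QuotientGroup.mk' N)
      (Subgroup.center_le_comap_center _ (QuotientGroup.mk'_surjective N)))
    (QuotientGroup.map_surjective_of_surjective _ _ _
      ((QuotientGroup.mk'_surjective _).comp (QuotientGroup.mk'_surjective N)) _)
end

section
/- Let p be an odd prime, let G be a finite p-group and suppose N is a powerfully embedded subgroup of G containing the commutator subgroup [G,G]. Then for all x, y ∈ G the order of the commutator [x,y] divides the order of y; equivalently, for every nonnegative integer i, if y^{p^i} = 1 then [x,y]^{p^i} = 1. -/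
section

open scoped commutatorElement

section ClassTwo

variable {G : Type*} [Group G]

theorem mul_pow_of_commute_commutator {x u c : G} (h : u * x = x * u * c)
    (hx : Commute c x) (hu : Commute c u) (n : ℕ) :
    (x * u) ^ n = x ^ n * u ^ n * c ^ n.choose 2 := by
  have hun : ∀ n : ℕ, u ^ n * x = x * u ^ n * c ^ n := by
    intro n
    induction n with
    | zero => simp
    | succ n ih =>
      calc u ^ (n + 1) * x = u ^ n * (u * x) := by rw [pow_succ, mul_assoc]
        _ = (u ^ n * x) * (u * c) := by rw [h]; simp only [mul_assoc]
        _ = x * u ^ n * (c ^ n * u) * c := by rw [ih]; simp only [mul_assoc]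
        _ = x * u ^ (n + 1) * c ^ (n + 1) := by
          rw [(hu.pow_left n).eq]; simp only [pow_succ, mul_assoc]
  induction n with
  | zero => simp
  | succ n ih =>
    calc (x * u) ^ (n + 1) = x ^ n * u ^ n * (c ^ n.choose 2 * (x * u)) := by
          rw [pow_succ, ih]; simp only [mul_assoc]
      _ = x ^ n * (u ^ n * x) * u * c ^ n.choose 2 := by
          rw [((hx.mul_right hu).pow_left _).eq]; simp only [mul_assoc]
      _ = x ^ n * x * u ^ n * (c ^ n * u) * c ^ n.choose 2 := by
          rw [hun]; simp only [mul_assoc]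
      _ = x ^ (n + 1) * u ^ (n + 1) * c ^ (n + 1).choose 2 := by
          rw [(hu.pow_left n).eq, Nat.choose_succ_succ' n 1, Nat.choose_one_right, pow_add c,
            pow_succ x, pow_succ u]
          simp only [mul_assoc]

theorem Odd.dvd_choose_two {p : ℕ} (hodd : Odd p) : p ∣ p.choose 2 := by
  obtain ⟨k, rfl⟩ := hodd
  refine ⟨k, ?_⟩
  rw [Nat.choose_two_right, Nat.add_sub_cancel]
  exact Nat.div_eq_of_eq_mul_left two_pos (by ring)

theorem mul_pow_of_odd {p : ℕ} (hodd : Odd p) {x u : G} (hp : ⁅u⁻¹, x⁻¹⁆ ^ p = 1)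
    (hx : Commute ⁅u⁻¹, x⁻¹⁆ x) (hu : Commute ⁅u⁻¹, x⁻¹⁆ u) :
    (x * u) ^ p = x ^ p * u ^ p := by
  obtain ⟨k, hk⟩ := hodd.dvd_choose_two
  rw [mul_pow_of_commute_commutator (c := ⁅u⁻¹, x⁻¹⁆) (by group) hx hu, hk, pow_mul, hp,
    one_pow, mul_one]

theorem QuotientGroup.commute_mk_iff {R : Subgroup G} [R.Normal] {a b : G} :
    Commute (a : G ⧸ R) (b : G ⧸ R) ↔ ⁅a, b⁆ ∈ R := by
  rw [← commutatorElement_eq_one_iff_commute, ← QuotientGroup.eq_one_iff]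
  rfl

theorem QuotientGroup.mk_mul_pow_of_odd {p : ℕ} (hodd : Odd p) {R : Subgroup G} [R.Normal]
    {x u : G} (hp : ⁅u⁻¹, x⁻¹⁆ ^ p ∈ R) (hx : ⁅⁅u⁻¹, x⁻¹⁆, x⁆ ∈ R) (hu : ⁅⁅u⁻¹, x⁻¹⁆, u⁆ ∈ R) :
    (((x * u) ^ p : G) : G ⧸ R) = ((x ^ p * u ^ p : G) : G ⧸ R) :=
  mul_pow_of_odd (G := G ⧸ R) (x := x) (u := u) hodd ((QuotientGroup.eq_one_iff _).2 hp)
    (QuotientGroup.commute_mk_iff.2 hx) (QuotientGroup.commute_mk_iff.2 hu)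

end ClassTwo

section PowSub

variable {G : Type*} [Group G]

/-- The subgroup generated by the `n`-th powers of the elements of `H`. -/
def Subgroup.powClosure (n : ℕ) (H : Subgroup G) : Subgroup G :=
  Subgroup.closure {x : G | ∃ h ∈ H, h ^ n = x}

namespace Subgroup

theorem pow_mem_powClosure {n : ℕ} {H : Subgroup G} {x : G} (hx : x ∈ H) :
    x ^ n ∈ H.powClosure n :=
  subset_closure ⟨x, hx, rfl⟩

theorem powClosure_le {n : ℕ} {H K : Subgroup G} :
    H.powClosure n ≤ K ↔ ∀ x ∈ H, x ^ n ∈ K := by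
  refine ⟨fun h x hx => h (pow_mem_powClosure hx), fun h => (closure_le _).2 ?_⟩
  rintro _ ⟨x, hx, rfl⟩
  exact h x hx

theorem powClosure_le_self (n : ℕ) (H : Subgroup G) : H.powClosure n ≤ H :=
  powClosure_le.2 fun _ hx => pow_mem hx n

theorem powClosure_mono (n : ℕ) {H K : Subgroup G} (h : H ≤ K) :
    H.powClosure n ≤ K.powClosure n :=
  powClosure_le.2 fun _ hx => pow_mem_powClosure (h hx)

instance powClosure_normal (n : ℕ) (H : Subgroup G) [hH : H.Normal] : (H.powClosure n).Normal where
  conj_mem x hx g := by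
    have : H.powClosure n ≤ (H.powClosure n).comap (MulAut.conj g).toMonoidHom := by
      refine powClosure_le.2 fun y hy => ?_
      have := pow_mem_powClosure (n := n) (hH.conj_mem y hy g)
      rwa [conj_pow] at this
    exact this hx

theorem map_powClosure {G' : Type*} [Group G'] (f : G →* G') (n : ℕ) (H : Subgroup G) :
    (H.powClosure n).map f = (H.map f).powClosure n := by
  apply le_antisymm
  · rw [map_le_iff_le_comap]
    refine powClosure_le.2 fun x hx => ?_
    rw [mem_comap, map_pow]
    exact pow_mem_powClosure (mem_map_of_mem f hx)
  · refine powClosure_le.2 ?_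
    rintro _ ⟨x, hx, rfl⟩
    rw [← map_pow]
    exact mem_map_of_mem f (pow_mem_powClosure hx)

theorem le_comap_center_mk_iff {X R : Subgroup G} [R.Normal] :
    X ≤ (center (G ⧸ R)).comap (QuotientGroup.mk' R) ↔ ⁅X, (⊤ : Subgroup G)⁆ ≤ R := by
  rw [commutator_le]
  refine forall₂_congr fun x _ => ?_
  rw [mem_comap, mem_center_iff]
  constructor
  · intro h g _
    exact QuotientGroup.commute_mk_iff.1 (h g).symm
  · rintro h ⟨g⟩
    exact (QuotientGroup.commute_mk_iff.2 (h g trivial)).eq.symm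

/-- The iterated `p`-th power series `G, G ^ p, (G ^ p) ^ p, …`. -/
def powSeries (p : ℕ) (G : Type*) [Group G] : ℕ → Subgroup G
  | 0 => ⊤
  | k + 1 => (powSeries p G k).powClosure p

instance powSeries_normal (p k : ℕ) : (powSeries p G k).Normal := by
  induction k with
  | zero => exact inferInstanceAs (⊤ : Subgroup G).Normal
  | succ k ih => exact powClosure_normal p _

theorem powSeries_antitone (p : ℕ) : Antitone (powSeries p G) :=
  antitone_nat_of_succ_le fun _ => powClosure_le_self p _

theorem map_powSeries {G' : Type*} [Group G'] (f : G →* G') (hf : Function.Surjective f)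
    (p k : ℕ) : (powSeries p G k).map f = powSeries p G' k := by
  induction k with
  | zero => exact map_top_of_surjective f hf
  | succ k ih => rw [powSeries, map_powClosure, ih, powSeries]

theorem le_of_le_sup_commutator_top [Group.IsNilpotent G] {X M : Subgroup G} [M.Normal]
    (h : X ≤ M ⊔ ⁅X, (⊤ : Subgroup G)⁆) : X ≤ M := by
  obtain ⟨n, hn⟩ := nilpotent_iff_lowerCentralSeries.1 (inferInstance : Group.IsNilpotent G)
  have key : ∀ n, X ≤ M ⊔ (⊤ : Subgroup G).lowerCentralSeries n := by
    intro n
    induction n with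
    | zero => simp
    | succ n ih =>
      refine h.trans (sup_le le_sup_left ((commutator_mono ih le_rfl).trans ?_))
      rw [← le_comap_center_mk_iff]
      exact sup_le (le_comap_center_mk_iff.2 ((commutator_le_left M ⊤).trans le_sup_left))
        (le_comap_center_mk_iff.2 le_sup_right)
  simpa [hn] using key n

end Subgroup

end PowSub

section PGroup

variable {G : Type*} [Group G] [Finite G] {p : ℕ}

open Subgroup

theorem IsPGroup.sup_powClosure_ne_top (hp : p.Prime) (hG : IsPGroup p G) {H : Subgroup G}
    (hH : H ≠ ⊤) : H ⊔ (⊤ : Subgroup G).powClosure p ≠ ⊤ := by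
  have := Fact.mk hp
  obtain ⟨n, hn⟩ := IsPGroup.iff_card.1 hG
  obtain ⟨m, hm⟩ := IsPGroup.iff_card.1 (hG.to_subgroup H)
  have hlt : m < n := by
    have h1 : Nat.card H < Nat.card G :=
      lt_of_le_of_ne (card_le_card_group H) fun h => hH (eq_top_of_card_eq H h)
    rw [hm, hn] at h1
    exact (Nat.pow_lt_pow_iff_right hp.one_lt).1 h1
  obtain ⟨k, rfl⟩ : ∃ k, n = k + 1 := ⟨n - 1, by omega⟩
  obtain ⟨M, hM, hHM⟩ := Sylow.exists_subgroup_card_pow_prime_le p (m := k)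
    (hn ▸ pow_dvd_pow p k.le_succ) H hm (by omega)
  have hidx : M.index = p := by
    have := M.card_mul_index
    rw [hM, hn, pow_succ] at this
    exact Nat.eq_of_mul_eq_mul_left (pow_pos hp.pos k) this
  have hMn : M.Normal := by
    apply normal_of_index_eq_minFac_card
    rw [hidx, hn, hp.pow_minFac k.succ_ne_zero]
  have hle : H ⊔ (⊤ : Subgroup G).powClosure p ≤ M :=
    sup_le hHM (powClosure_le.2 fun x _ => hidx ▸ M.pow_index_mem x)
  intro h
  rw [h, top_le_iff, ← index_eq_one, hidx] at hle
  exact hp.one_lt.ne' hle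

theorem IsPGroup.powClosure_lt (hp : p.Prime) (hG : IsPGroup p G) {H : Subgroup G}
    (hH : H ≠ ⊥) : H.powClosure p < H := by
  refine lt_of_le_of_ne (powClosure_le_self p H) fun h => ?_
  have hne : (⊥ : Subgroup H) ≠ ⊤ := by
    intro hbt
    apply hH
    rw [← H.range_subtype, MonoidHom.range_eq_map, ← hbt, Subgroup.map_bot]
  apply (hG.to_subgroup H).sup_powClosure_ne_top hp hne
  rw [bot_sup_eq]
  apply map_injective H.subtype_injective
  rw [map_powClosure, ← MonoidHom.range_eq_map, range_subtype, h]

theorem IsPGroup.exists_powSeries_eq_bot (hp : p.Prime) (hG : IsPGroup p G) :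
    ∃ n, powSeries p G n = ⊥ := by
  obtain ⟨n, hn⟩ := WellFoundedGT.monotone_chain_condition
    (⟨fun k => OrderDual.toDual (powSeries p G k), powSeries_antitone p⟩ : ℕ →o (Subgroup G)ᵒᵈ)
  refine ⟨n, ?_⟩
  by_contra h
  exact (hG.powClosure_lt hp h).ne (hn (n + 1) n.le_succ).symm

theorem Subgroup.commutator_powClosure_le (hp : p.Prime) (hodd : Odd p) (hG : IsPGroup p G)
    {N : Subgroup G} [N.Normal] (hN : ⁅N, (⊤ : Subgroup G)⁆ ≤ N.powClosure p) :
    ⁅N.powClosure p, (⊤ : Subgroup G)⁆ ≤ (N.powClosure p).powClosure p := by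
  have := Fact.mk hp
  have := hG.isNilpotent
  apply le_of_le_sup_commutator_top
  set X := ⁅N.powClosure p, (⊤ : Subgroup G)⁆ with hX
  set R := (N.powClosure p).powClosure p ⊔ ⁅X, (⊤ : Subgroup G)⁆ with hR
  rw [← le_comap_center_mk_iff]
  refine powClosure_le.2 fun x hx => ?_
  rw [mem_comap, mem_center_iff]
  rintro ⟨g⟩
  have hu : ⁅x⁻¹, g⁻¹⁆ ∈ N.powClosure p :=
    hN (commutator_mem_commutator (inv_mem hx) (mem_top _))
  set u := ⁅x⁻¹, g⁻¹⁆ with hu_def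
  have hc : ⁅u⁻¹, x⁻¹⁆ ∈ X := commutator_mem_commutator (inv_mem hu) (mem_top _)
  have hcR : ∀ z, ⁅⁅u⁻¹, x⁻¹⁆, z⁆ ∈ R := fun z =>
    hR ▸ mem_sup_right (commutator_mem_commutator hc (mem_top z))
  have hup : ((u ^ p : G) : G ⧸ R) = 1 :=
    (QuotientGroup.eq_one_iff _).2 (hR ▸ mem_sup_left (pow_mem_powClosure hu))
  have hcp : ⁅u⁻¹, x⁻¹⁆ ^ p ∈ R := by
    rw [← QuotientGroup.eq_one_iff]
    have h1 : x⁻¹ * u * x = u * ⁅u⁻¹, x⁻¹⁆ := by group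
    have h2 : Commute (u : G ⧸ R) (⁅u⁻¹, x⁻¹⁆ : G) := (QuotientGroup.commute_mk_iff.2 (hcR u)).symm
    have h3 : (((x⁻¹ * u * x) ^ p : G) : G ⧸ R) = 1 := by
      have : (x⁻¹ * u * x) ^ p = x⁻¹ * u ^ p * x := by simpa using conj_pow (a := x⁻¹) (b := u)
      rw [this, QuotientGroup.mk_mul, QuotientGroup.mk_mul, hup, mul_one, ← QuotientGroup.mk_mul,
        inv_mul_cancel, QuotientGroup.mk_one]
    rw [h1, QuotientGroup.mk_pow, QuotientGroup.mk_mul, h2.mul_pow, ← QuotientGroup.mk_pow, hup,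
      one_mul] at h3
    exact h3
  have h4 := QuotientGroup.mk_mul_pow_of_odd hodd hcp (hcR x) (hcR u)
  have h5 : (x * u) ^ p = g⁻¹ * x ^ p * g := by
    have : x * u = g⁻¹ * x * g := by rw [hu_def]; group
    rw [this]
    simpa using conj_pow (a := g⁻¹) (b := x)
  rw [h5, QuotientGroup.mk_mul _ (x ^ p) (u ^ p), hup, mul_one] at h4
  have h6 : ((g * (g⁻¹ * x ^ p * g) : G) : G ⧸ R) = ((g * x ^ p : G) : G ⧸ R) := by
    rw [QuotientGroup.mk_mul, h4, QuotientGroup.mk_mul]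
  have h7 : g * (g⁻¹ * x ^ p * g) = x ^ p * g := by group
  rw [h7] at h6
  exact h6.symm

theorem Subgroup.commutator_powSeries_le (hp : p.Prime) (hodd : Odd p) (hG : IsPGroup p G)
    (h : _root_.commutator G ≤ (⊤ : Subgroup G).powClosure p) (k : ℕ) :
    ⁅powSeries p G k, (⊤ : Subgroup G)⁆ ≤ powSeries p G (k + 1) := by
  induction k with
  | zero => exact h
  | succ k ih => exact commutator_powClosure_le hp hodd hG ih

theorem Subgroup.mk_mul_pow_of_mem_powSeries (hp : p.Prime) (hodd : Odd p) (hG : IsPGroup p G)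
    (h : _root_.commutator G ≤ (⊤ : Subgroup G).powClosure p) {k : ℕ} (x : G) {z : G}
    (hz : z ∈ powSeries p G k) :
    (((x * z) ^ p : G) : G ⧸ powSeries p G (k + 2)) = ((x ^ p * z ^ p : G) : G ⧸ _) := by
  have hc : ⁅z⁻¹, x⁻¹⁆ ∈ powSeries p G (k + 1) :=
    commutator_powSeries_le hp hodd hG h k (commutator_mem_commutator (inv_mem hz) (mem_top _))
  have hc' : ∀ g, ⁅⁅z⁻¹, x⁻¹⁆, g⁆ ∈ powSeries p G (k + 2) := fun g =>
    commutator_powSeries_le hp hodd hG h (k + 1) (commutator_mem_commutator hc (mem_top _))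
  exact QuotientGroup.mk_mul_pow_of_odd hodd (pow_mem_powClosure hc) (hc' x) (hc' z)

theorem Subgroup.exists_mk_pow_eq_of_mem_powSeries (hp : p.Prime) (hodd : Odd p)
    (hG : IsPGroup p G) (h : _root_.commutator G ≤ (⊤ : Subgroup G).powClosure p) {k : ℕ} {w : G}
    (hw : w ∈ powSeries p G (k + 1)) :
    ∃ z ∈ powSeries p G k, ((z ^ p : G) : G ⧸ powSeries p G (k + 2)) = w := by
  induction hw using closure_induction with
  | mem w hw =>
    obtain ⟨z, hz, rfl⟩ := hw
    exact ⟨z, hz, rfl⟩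
  | one => exact ⟨1, one_mem _, by rw [one_pow]⟩
  | mul a b _ _ iha ihb =>
    obtain ⟨x, hx, hxa⟩ := iha
    obtain ⟨z, hz, hzb⟩ := ihb
    refine ⟨x * z, mul_mem hx hz, ?_⟩
    rw [mk_mul_pow_of_mem_powSeries hp hodd hG h x hz, QuotientGroup.mk_mul, hxa, hzb,
      QuotientGroup.mk_mul]
  | inv a _ iha =>
    obtain ⟨x, hx, hxa⟩ := iha
    exact ⟨x⁻¹, inv_mem hx, by rw [inv_pow, QuotientGroup.mk_inv, hxa, QuotientGroup.mk_inv]⟩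

theorem Subgroup.exists_pow_eq_of_mem_powSeries (hp : p.Prime) (hodd : Odd p)
    (hG : IsPGroup p G) (h : _root_.commutator G ≤ (⊤ : Subgroup G).powClosure p) {k : ℕ} {w : G}
    (hw : w ∈ powSeries p G (k + 1)) : ∃ e ∈ powSeries p G k, e ^ p = w := by
  have key : ∀ j, ∃ e ∈ powSeries p G k, (e ^ p)⁻¹ * w ∈ powSeries p G (k + j + 1) := by
    intro j
    induction j with
    | zero => exact ⟨1, one_mem _, by simpa using hw⟩
    | succ j ih =>
      obtain ⟨e, he, hew⟩ := ih
      obtain ⟨z, hz, hzw⟩ := exists_mk_pow_eq_of_mem_powSeries hp hodd hG h hew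
      refine ⟨e * z, mul_mem he (powSeries_antitone p (Nat.le_add_right k j) hz), ?_⟩
      have h1 := mk_mul_pow_of_mem_powSeries hp hodd hG h e hz
      rw [QuotientGroup.mk_mul, hzw, ← QuotientGroup.mk_mul, mul_inv_cancel_left] at h1
      exact QuotientGroup.eq.1 h1
  obtain ⟨n, hn⟩ := hG.exists_powSeries_eq_bot hp
  obtain ⟨e, he, hew⟩ := key n
  have := powSeries_antitone p (show n ≤ k + n + 1 by omega) hew
  rw [hn, mem_bot, inv_mul_eq_one] at this
  exact ⟨e, he, this⟩

end PGroup

section Powerful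

open Subgroup

theorem Subgroup.commutator_zpowers_sup_le {G : Type*} [Group G] {N R : Subgroup G} [R.Normal]
    (hN : ⁅N, (⊤ : Subgroup G)⁆ ≤ R) (y : G) : ⁅zpowers y ⊔ N, zpowers y ⊔ N⁆ ≤ R := by
  have hNc := le_comap_center_mk_iff.2 hN
  have hle : ∀ g : G, (∀ t ∈ zpowers y, ⁅g, t⁆ ∈ R) → ∀ t ∈ zpowers y ⊔ N, ⁅g, t⁆ ∈ R := by
    intro g hg t ht
    have h : zpowers y ⊔ N ≤ (centralizer {(g : G ⧸ R)}).comap (QuotientGroup.mk' R) := by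
      refine sup_le (fun s hs => ?_) (fun s hs => ?_)
      · rw [mem_comap, mem_centralizer_singleton_iff]
        exact (QuotientGroup.commute_mk_iff.2 (hg s hs)).eq.symm
      · exact center_le_centralizer _ (hNc hs)
    have ht' := h ht
    rw [mem_comap, mem_centralizer_singleton_iff] at ht'
    exact QuotientGroup.commute_mk_iff.1 (Eq.symm ht')
  refine commutator_le.2 fun s hs t ht => hle s (fun z hz => ?_) t ht
  rw [← inv_mem_iff, commutatorElement_inv]
  refine hle z (fun z' hz' => ?_) s hs
  obtain ⟨a, rfl⟩ := mem_zpowers_iff.1 hz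
  obtain ⟨b, rfl⟩ := mem_zpowers_iff.1 hz'
  rw [((Commute.refl y).zpow_zpow a b).commutator_eq]
  exact one_mem R

theorem Subgroup.commutator_zpowers_sup_le_powClosure {G : Type*} [Group G] {p : ℕ}
    {N : Subgroup G} [N.Normal] (hN : ⁅N, (⊤ : Subgroup G)⁆ ≤ N.powClosure p) (y : G) :
    _root_.commutator ↥(zpowers y ⊔ N) ≤ (⊤ : Subgroup ↥(zpowers y ⊔ N)).powClosure p := by
  rw [← map_le_map_iff_of_injective (zpowers y ⊔ N).subtype_injective, map_powClosure,
    ← MonoidHom.range_eq_map, range_subtype, map_subtype_commutator]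
  exact (commutator_zpowers_sup_le hN y).trans (powClosure_mono p le_sup_right)

theorem Subgroup.commutator_quotient_le_powClosure {G : Type*} [Group G] {p : ℕ}
    (h : _root_.commutator G ≤ (⊤ : Subgroup G).powClosure p) (R : Subgroup G) [R.Normal] :
    _root_.commutator (G ⧸ R) ≤ (⊤ : Subgroup (G ⧸ R)).powClosure p := by
  have hs := QuotientGroup.mk'_surjective R
  have := map_mono (f := QuotientGroup.mk' R) h
  rwa [map_powClosure, map_top_of_surjective _ hs, _root_.commutator_def, map_commutator,
    map_top_of_surjective _ hs] at this

theorem Subgroup.normal_of_commutator_le {G : Type*} [Group G] {H : Subgroup G}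
    (h : _root_.commutator G ≤ H) : H.Normal :=
  commutator_top_left_le_iff.1 ((commutator_mono le_rfl le_top).trans h)

/-- The elements `g ∈ T` with `g ^ n = 1`, as a subgroup when these are closed under products. -/
def Subgroup.torsionOf {G : Type*} [Group G] (T : Subgroup G) (n : ℕ)
    (hT : ∀ a b : T, a ^ n = 1 → b ^ n = 1 → (a * b) ^ n = 1) : Subgroup G where
  carrier := {g | g ∈ T ∧ g ^ n = 1}
  one_mem' := ⟨one_mem T, one_pow n⟩
  mul_mem' {a b} ha hb := ⟨mul_mem ha.1 hb.1, by
    simpa [Subtype.ext_iff] using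
      hT ⟨a, ha.1⟩ ⟨b, hb.1⟩ (Subtype.ext ha.2) (Subtype.ext hb.2)⟩
  inv_mem' {a} ha := ⟨inv_mem ha.1, by rw [inv_pow, ha.2, inv_one]⟩

theorem Subgroup.mem_torsionOf {G : Type*} [Group G] {T : Subgroup G} {n : ℕ}
    {hT : ∀ a b : T, a ^ n = 1 → b ^ n = 1 → (a * b) ^ n = 1} {g : G} :
    g ∈ T.torsionOf n hT ↔ g ∈ T ∧ g ^ n = 1 :=
  Iff.rfl

instance Subgroup.torsionOf_normal {G : Type*} [Group G] {T : Subgroup G} [hTn : T.Normal]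
    (n : ℕ) (hT : ∀ a b : T, a ^ n = 1 → b ^ n = 1 → (a * b) ^ n = 1) :
    (T.torsionOf n hT).Normal where
  conj_mem x hx g := ⟨hTn.conj_mem x hx.1 g, by rw [conj_pow, hx.2, mul_one, mul_inv_cancel]⟩

theorem Subgroup.zpowers_eq_top_of_sup_powSeries_one_eq_top {G : Type*} [Group G] [Finite G] {p : ℕ}
    (hp : p.Prime) (hG : IsPGroup p G) {y : G} (h : zpowers y ⊔ powSeries p G 1 = ⊤) :
    zpowers y = ⊤ := by
  by_contra hne
  exact hG.sup_powClosure_ne_top hp hne h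

theorem mul_pow_eq_one_and_commute_of_powerful {p : ℕ} (hp : p.Prime) (hodd : Odd p) (n : ℕ) :
    ∀ (G : Type*) [Group G] [Finite G], Nat.card G < n → IsPGroup p G →
      _root_.commutator G ≤ (⊤ : Subgroup G).powClosure p →
      (∀ a b : G, a ^ p = 1 → b ^ p = 1 → (a * b) ^ p = 1) ∧
      ∀ k, ∀ w ∈ powSeries p G k, ∀ y : G, w ^ p = 1 → y ^ p ^ k = 1 → Commute w y := by
  induction n with
  | zero => intro G _ _ h; omega
  | succ n ih =>
  intro G _ _ hn hG hpow
  by_cases hcyc : ∃ y : G, zpowers y = ⊤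
  · obtain ⟨y, hy⟩ := hcyc
    have hcomm : ∀ a b : G, Commute a b := by
      intro a b
      obtain ⟨i, rfl⟩ := mem_zpowers_iff.1 (hy ▸ mem_top a)
      obtain ⟨j, rfl⟩ := mem_zpowers_iff.1 (hy ▸ mem_top b)
      exact (Commute.refl y).zpow_zpow i j
    exact ⟨fun a b ha hb => by rw [(hcomm a b).mul_pow, ha, hb, one_mul],
      fun _ w _ y _ _ => hcomm w y⟩
  have hcent := commutator_powSeries_le hp hodd hG hpow
  have hTc : ∀ y : G, _root_.commutator G ≤ zpowers y ⊔ powSeries p G 1 := fun y =>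
    hpow.trans le_sup_right
  have hTn : ∀ y : G, (zpowers y ⊔ powSeries p G 1).Normal := fun y =>
    normal_of_commutator_le (hTc y)
  have hT : ∀ y : G, ∀ a b : ↥(zpowers y ⊔ powSeries p G 1),
      a ^ p = 1 → b ^ p = 1 → (a * b) ^ p = 1 := by
    intro y
    refine (ih _ ?_ (hG.to_subgroup _) (commutator_zpowers_sup_le_powClosure (hcent 1) y)).1
    refine lt_of_lt_of_le (lt_of_le_of_ne (card_le_card_group _) fun h => hcyc ⟨y, ?_⟩)
      (Nat.lt_succ_iff.1 hn)
    exact zpowers_eq_top_of_sup_powSeries_one_eq_top hp hG (eq_top_of_card_eq _ h)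
  have hY : ∀ k, ∀ w ∈ powSeries p G k, ∀ y : G, w ^ p = 1 → y ^ p ^ k = 1 → Commute w y := by
    obtain ⟨m, hm⟩ := hG.exists_powSeries_eq_bot hp
    suffices ∀ d k, m ≤ k + d → ∀ w ∈ powSeries p G k, ∀ y : G, w ^ p = 1 → y ^ p ^ k = 1 →
        Commute w y from fun k => this m k (Nat.le_add_left m k)
    intro d
    induction d with
    | zero =>
      intro k hk w hw y _ _
      have := powSeries_antitone p hk hw
      rw [hm, mem_bot] at this
      exact this ▸ Commute.one_left y
    | succ d ihd =>
      rintro (_ | j) hk w hw y hwp hy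
      · rw [pow_zero, pow_one] at hy
        exact hy ▸ Commute.one_right w
      obtain ⟨e, he, rfl⟩ := exists_pow_eq_of_mem_powSeries hp hodd hG hpow hw
      have := hTn y
      set Ω := (zpowers y ⊔ powSeries p G 1).torsionOf p (hT y) with hΩ
      by_cases hy1 : y = 1
      · exact hy1 ▸ Commute.one_right _
      have hyT : ∀ i : ℕ, y ^ i ∈ zpowers y ⊔ powSeries p G 1 := fun i =>
        mem_sup_left (pow_mem (mem_zpowers y) i)
      have hΩne : Ω ≠ ⊥ := by
        intro hbot
        have hy' : ∀ i, y ^ p ^ i = 1 → y = 1 := by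
          intro i
          induction i with
          | zero => simp
          | succ i ihi =>
            intro hi
            refine ihi ((mem_bot (G := G)).1 (hbot ▸ mem_torsionOf.2 ⟨hyT _, ?_⟩))
            rw [← pow_mul, ← pow_succ, hi]
        exact hy1 (hy' _ hy)
      have hu : ⁅e⁻¹, y⁻¹⁆ ∈ Ω := by
        have hcard : Nat.card (G ⧸ Ω) < n := by
          have h1 := Ω.card_eq_card_quotient_mul_card_subgroup
          have h2 : 1 < Nat.card Ω := (one_lt_card_iff_ne_bot Ω).2 hΩne
          have h3 : 0 < Nat.card (G ⧸ Ω) := Nat.card_pos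
          nlinarith
        have hQ := (ih (G ⧸ Ω) hcard (hG.to_quotient Ω)
          (commutator_quotient_le_powClosure hpow Ω)).2 j (e : G ⧸ Ω)
          (map_powSeries _ (QuotientGroup.mk'_surjective Ω) p j ▸ mem_map_of_mem _ he)
          (y : G ⧸ Ω)
          ((QuotientGroup.eq_one_iff _).2 (mem_torsionOf.2
            ⟨mem_sup_right (powSeries_antitone p (by omega) hw), hwp⟩))
          ((QuotientGroup.eq_one_iff _).2 (mem_torsionOf.2
            ⟨hyT _, by rw [← pow_mul, ← pow_succ, hy]⟩))
        exact QuotientGroup.commute_mk_iff.1 hQ.inv_inv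
      set u := ⁅e⁻¹, y⁻¹⁆ with hu_def
      have huP : u ∈ powSeries p G (j + 1) :=
        hcent j (commutator_mem_commutator (inv_mem he) (mem_top _))
      have hvP : ⁅u⁻¹, e⁻¹⁆ ∈ powSeries p G (j + 2) :=
        hcent (j + 1) (commutator_mem_commutator (inv_mem huP) (mem_top _))
      have hvp : ⁅u⁻¹, e⁻¹⁆ ^ p = 1 := by
        have : ⁅u⁻¹, e⁻¹⁆ ∈ Ω :=
          commutator_le_left Ω ⊤ (commutator_mem_commutator (inv_mem hu) (mem_top _))
        exact this.2
      have hve := ihd (j + 2) (by omega) _ hvP e hvp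
        (by rw [add_comm, pow_add, pow_mul, pow_two, pow_mul, hwp, one_pow])
      have hvu := ihd (j + 2) (by omega) _ hvP u hvp (by
        rw [pow_succ', pow_mul, hu.2, one_pow])
      have h1 := mul_pow_of_odd hodd hvp hve hvu
      have h2 : e * u = y⁻¹ * e * y := by rw [hu_def]; group
      have h3 : (y⁻¹ * e * y) ^ p = y⁻¹ * e ^ p * y := by simpa using conj_pow (a := y⁻¹) (b := e)
      rw [hu.2, mul_one, h2, h3] at h1
      calc e ^ p * y = y * (y⁻¹ * e ^ p * y) := by group
        _ = y * e ^ p := by rw [h1]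
  refine ⟨fun a b ha hb => ?_, hY⟩
  have hcP : ⁅b⁻¹, a⁻¹⁆ ∈ powSeries p G 1 :=
    hcent 0 (commutator_mem_commutator (mem_top _) (mem_top _))
  have hcp : ⁅b⁻¹, a⁻¹⁆ ^ p = 1 := by
    have := hTn a
    have haΩ : a⁻¹ ∈ (zpowers a ⊔ powSeries p G 1).torsionOf p (hT a) :=
      inv_mem (mem_torsionOf.2 ⟨mem_sup_left (mem_zpowers a), ha⟩)
    exact (commutator_le_right ⊤ _ (commutator_mem_commutator (mem_top _) haΩ)).2
  rw [mul_pow_of_odd hodd hcp (hY 1 _ hcP a hcp (by rwa [pow_one]))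
    (hY 1 _ hcP b hcp (by rwa [pow_one])), ha, hb, one_mul]

theorem mul_pow_prime_pow_eq_one_of_powerful {p : ℕ} (hp : p.Prime) (hodd : Odd p) (i : ℕ) :
    ∀ (G : Type*) [Group G] [Finite G], IsPGroup p G →
      _root_.commutator G ≤ (⊤ : Subgroup G).powClosure p →
      ∀ a b : G, a ^ p ^ i = 1 → b ^ p ^ i = 1 → (a * b) ^ p ^ i = 1 := by
  induction i with
  | zero =>
    intro G _ _ _ _ a b ha hb
    rw [pow_zero, pow_one] at *
    rw [ha, hb, one_mul]
  | succ i ih =>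
    intro G _ _ hG hpow a b ha hb
    have hS := (mul_pow_eq_one_and_commute_of_powerful hp hodd _ G (Nat.lt_succ_self _) hG hpow).1
    set Ω := (⊤ : Subgroup G).torsionOf p fun a b ha hb => Subtype.ext
      (hS a b (congrArg Subtype.val ha) (congrArg Subtype.val hb)) with hΩ
    have hmem : ∀ g : G, (g : G ⧸ Ω) ^ p ^ i = 1 ↔ g ^ p ^ (i + 1) = 1 := by
      intro g
      rw [← QuotientGroup.mk_pow, QuotientGroup.eq_one_iff, hΩ, mem_torsionOf, ← pow_mul,
        ← pow_succ]
      exact and_iff_right (mem_top _)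
    exact (hmem (a * b)).1 (ih (G ⧸ Ω) (hG.to_quotient Ω)
      (commutator_quotient_le_powClosure hpow Ω) a b ((hmem a).2 ha) ((hmem b).2 hb))

end Powerful

end

theorem orderOf_commutator_dvd_of_powerfully_embedded (p : ℕ) (hp : p.Prime) (hodd : Odd p)
    (G : Type*) [Group G] [Finite G]
    (hG : IsPGroup p G) (N : Subgroup G) (hN : N.Normal)
    (hemb : ⁅N, (⊤ : Subgroup G)⁆ ≤ Subgroup.closure {x : G | ∃ n ∈ N, n ^ p = x})
    (hcomm : commutator G ≤ N) (x y : G) :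
    orderOf (pcomm x y) ∣ orderOf y := by
  have := Fact.mk hp
  obtain ⟨i, hi⟩ := IsPGroup.iff_orderOf.1 hG y
  have hyi : y ^ p ^ i = 1 := hi ▸ pow_orderOf_eq_one y
  have hHn : (Subgroup.zpowers y ⊔ N).Normal :=
    Subgroup.normal_of_commutator_le (hcomm.trans le_sup_right)
  have hy : y ∈ Subgroup.zpowers y ⊔ N := Subgroup.mem_sup_left (Subgroup.mem_zpowers y)
  have hx : x⁻¹ * y⁻¹ * x ∈ Subgroup.zpowers y ⊔ N := by
    simpa using hHn.conj_mem _ (inv_mem hy) x⁻¹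
  have hxi : (x⁻¹ * y⁻¹ * x) ^ p ^ i = 1 := by
    have := conj_pow (i := p ^ i) (a := x⁻¹) (b := y⁻¹)
    rw [inv_inv, inv_pow, hyi, inv_one, mul_one, inv_mul_cancel] at this
    exact this
  rw [hi]
  refine orderOf_dvd_of_pow_eq_one ?_
  exact congrArg Subtype.val (mul_pow_prime_pow_eq_one_of_powerful hp hodd i _
    (hG.to_subgroup _) (Subgroup.commutator_zpowers_sup_le_powClosure hemb y)
    ⟨_, hx⟩ ⟨y, hy⟩ (Subtype.ext hxi) (Subtype.ext hyi))
end
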